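/- Let n ≥ 1, β ≥ n, and let W : ℝⁿ → (0,∞) be convex and C² on ℝⁿ with ∫ W^{−β} = 1, and suppose the Hessian D²W(x) is positive definite for every x ∈ ℝⁿ; set ρ_{β,W} = W^{−β}. Then for every C¹ compactly supported function g with ∫ g ρ_{β,W} = 0, setting f = g·W, one has ∫ ⟨(D²W)^{-1}∇f, ∇f⟩ ρ_{β,W} ≥ β·∫ g²·W·ρ_{β,W}. -/

import Mathlib

open MeasureTheory
open scoped RealInnerProductSpace

section ParametricIntegral

variable {E G : Type} [NormedAddCommGroup E] [NormedSpace ℝ E] [FiniteDimensional ℝ E]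
  [NormedAddCommGroup G] [NormedSpace ℝ G]

theorem hasFDerivAt_intervalIntegral_of_contDiff {F : E → ℝ → G}
    (hF : ContDiff ℝ 1 (Function.uncurry F)) (a b : ℝ) (x : E) :
    HasFDerivAt (fun y => ∫ s in a..b, F y s)
      (∫ s in a..b, (fderiv ℝ (Function.uncurry F) (x, s)).comp
        (ContinuousLinearMap.inl ℝ E ℝ)) x := by
  have : ProperSpace E := FiniteDimensional.proper_real E
  have hF' : Continuous fun p : E × ℝ => (fderiv ℝ (Function.uncurry F) p).comp
      (ContinuousLinearMap.inl ℝ E ℝ) :=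
    (hF.continuous_fderiv one_ne_zero).clm_comp continuous_const
  obtain ⟨C, hC⟩ := ((isCompact_closedBall x 1).prod (isCompact_uIcc (a := a) (b := b))).exists_bound_of_continuousOn
    hF'.continuousOn
  have hc : ∀ y, Continuous (F y) := fun y =>
    hF.continuous.comp (Continuous.prodMk continuous_const continuous_id)
  refine intervalIntegral.hasFDerivAt_integral_of_dominated_of_fderiv_le
    (F' := fun y s => (fderiv ℝ (Function.uncurry F) (y, s)).comp
        (ContinuousLinearMap.inl ℝ E ℝ)) (bound := fun _ => C)
    (Metric.closedBall_mem_nhds x one_pos) ?_ ?_ ?_ ?_ ?_ ?_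
  · exact .of_forall fun y => (hc y).aestronglyMeasurable
  · exact (hc x).intervalIntegrable _ _
  · exact (hF'.comp (Continuous.prodMk continuous_const continuous_id)).aestronglyMeasurable
  · refine .of_forall fun s hs y hy => hC (y, s) ⟨hy, Set.uIoc_subset_uIcc hs⟩
  · exact intervalIntegrable_const
  · refine .of_forall fun s hs y hy => ?_
    exact HasFDerivAt.comp (g := Function.uncurry F) (f := fun e => (e, s)) y
      (hF.differentiable one_ne_zero (y, s)).hasFDerivAt (hasFDerivAt_prodMk_left y s)

theorem contDiff_intervalIntegral (k : ℕ) : ∀ {G : Type} [NormedAddCommGroup G] [NormedSpace ℝ G]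
    [CompleteSpace G] {F : E → ℝ → G}, ContDiff ℝ k (Function.uncurry F) → ∀ a b : ℝ,
    ContDiff ℝ k fun y => ∫ s in a..b, F y s := by
  induction k with
  | zero =>
    intro G _ _ _ F hF a b
    exact contDiff_zero.2 (intervalIntegral.continuous_parametric_intervalIntegral_of_continuous'
      (contDiff_zero.1 hF) a b)
  | succ k ih =>
    intro G _ _ _ F hF a b
    refine (contDiff_succ_iff_hasFDerivAt (n := k)).2 ⟨_, ?_, fun x =>
      hasFDerivAt_intervalIntegral_of_contDiff (hF.of_le (by norm_cast; omega)) a b x⟩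
    refine ih (F := fun y s => (fderiv ℝ (Function.uncurry F) (y, s)).comp
        (ContinuousLinearMap.inl ℝ E ℝ)) ?_ a b
    exact (hF.fderiv_right (m := k) (by norm_cast)).clm_comp contDiff_const

theorem contDiff_primitive (k : ℕ) {F : E → ℝ → ℝ} (hF : ContDiff ℝ k (Function.uncurry F))
    (a : ℝ) {t : E → ℝ} (ht : ContDiff ℝ k t) :
    ContDiff ℝ k fun y => ∫ s in a..t y, F y s := by
  have h : (fun y => ∫ s in a..t y, F y s) =
      fun y => (t y - a) * ∫ s in (0 : ℝ)..1, F y (a + (t y - a) * s) := by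
    ext y
    rw [intervalIntegral.mul_integral_comp_add_mul]
    simp
  rw [h]
  refine (ht.sub contDiff_const).mul (contDiff_intervalIntegral k ?_ 0 1)
  exact hF.comp (contDiff_fst.prodMk (contDiff_const.add
    (((ht.comp contDiff_fst).sub contDiff_const).mul contDiff_snd)))

end ParametricIntegral

/-- The `i`-th partial derivative of a function on `ℝⁿ`. -/
noncomputable def partialDeriv {n : ℕ} (i : Fin n) (F : (Fin n → ℝ) → ℝ) (x : Fin n → ℝ) : ℝ :=
  fderiv ℝ F x (Pi.single i 1)

section PartialDeriv

variable {n : ℕ}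

theorem ContDiff.partialDeriv {k m : ℕ} {F : (Fin n → ℝ) → ℝ} (hF : ContDiff ℝ k F) (hm : m + 1 ≤ k)
    (i : Fin n) : ContDiff ℝ m (partialDeriv i F) :=
  (hF.fderiv_right (m := m) (by exact_mod_cast hm)).clm_apply contDiff_const

theorem ContDiff.continuous_partialDeriv {F : (Fin n → ℝ) → ℝ} (hF : ContDiff ℝ 1 F)
    (i : Fin n) : Continuous (_root_.partialDeriv i F) :=
  (hF.continuous_fderiv one_ne_zero).clm_apply continuous_const

theorem partialDeriv_mul {F H : (Fin n → ℝ) → ℝ} (hF : ContDiff ℝ 1 F) (hH : ContDiff ℝ 1 H)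
    (i : Fin n) (x : Fin n → ℝ) :
    partialDeriv i (fun y => F y * H y) x =
      F x * partialDeriv i H x + H x * partialDeriv i F x := by
  simp only [partialDeriv]
  rw [fderiv_fun_mul (hF.differentiable one_ne_zero x) (hH.differentiable one_ne_zero x)]
  simp

theorem contDiff_cons {k : WithTop ℕ∞} :
    ContDiff ℝ k fun p : (Fin n → ℝ) × ℝ => (Fin.cons p.2 p.1 : Fin (n + 1) → ℝ) := by
  refine contDiff_pi.2 fun i => ?_
  refine Fin.cases ?_ (fun j => ?_) i
  · exact contDiff_snd
  · exact (contDiff_apply ℝ ℝ j).comp contDiff_fst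

theorem contDiff_tail {k : WithTop ℕ∞} :
    ContDiff ℝ k fun (x : Fin (n + 1) → ℝ) => (Fin.tail x : Fin n → ℝ) :=
  contDiff_pi.2 fun j => contDiff_apply ℝ ℝ j.succ

theorem hasFDerivAt_cons (s : ℝ) (y : Fin n → ℝ) :
    HasFDerivAt (fun z : Fin n → ℝ => (Fin.cons s z : Fin (n + 1) → ℝ))
      (ContinuousLinearMap.pi (R := ℝ) (φ := fun _ : Fin (n + 1) => ℝ)
        (Fin.cases 0 fun j => ContinuousLinearMap.proj (R := ℝ) (φ := fun _ : Fin n => ℝ) j)) y := by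
  refine hasFDerivAt_pi'' fun i => ?_
  refine Fin.cases ?_ (fun j => ?_) i
  · simpa using hasFDerivAt_const s y
  · simpa using hasFDerivAt_apply j y

theorem hasFDerivAt_tail (x : Fin (n + 1) → ℝ) :
    HasFDerivAt (fun z : Fin (n + 1) → ℝ => (Fin.tail z : Fin n → ℝ))
      (ContinuousLinearMap.pi (R := ℝ) (φ := fun _ : Fin n => ℝ)
        fun j => ContinuousLinearMap.proj (R := ℝ) (φ := fun _ : Fin (n + 1) => ℝ) j.succ) x :=
  hasFDerivAt_pi'' fun j => hasFDerivAt_apply j.succ x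

theorem partialDeriv_cons {H : (Fin (n + 1) → ℝ) → ℝ} (hH : Differentiable ℝ H)
    (i : Fin n) (s : ℝ) (y : Fin n → ℝ) :
    partialDeriv i (fun z => H (Fin.cons s z)) y = partialDeriv i.succ H (Fin.cons s y) := by
  have h := HasFDerivAt.comp (g := H) y (hH _).hasFDerivAt (hasFDerivAt_cons s y)
  simp only [partialDeriv]
  erw [h.fderiv]
  simp only [ContinuousLinearMap.comp_apply]
  congr 1
  ext j
  refine Fin.cases ?_ (fun j => ?_) j
  · simp
  · simp [Pi.single_apply]

theorem partialDeriv_tail_succ {H : (Fin n → ℝ) → ℝ} (hH : Differentiable ℝ H)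
    (i : Fin n) (x : Fin (n + 1) → ℝ) :
    partialDeriv i.succ (fun z => H (Fin.tail z)) x = partialDeriv i H (Fin.tail x) := by
  have h := HasFDerivAt.comp (g := H) x (hH _).hasFDerivAt (hasFDerivAt_tail x)
  simp only [partialDeriv]
  erw [h.fderiv]
  simp only [ContinuousLinearMap.comp_apply]
  congr 1
  ext j
  simp [Pi.single_apply]

theorem partialDeriv_tail_zero {H : (Fin n → ℝ) → ℝ} (hH : Differentiable ℝ H)
    (x : Fin (n + 1) → ℝ) :
    partialDeriv 0 (fun z => H (Fin.tail z)) x = 0 := by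
  have h := HasFDerivAt.comp (g := H) x (hH _).hasFDerivAt (hasFDerivAt_tail x)
  simp only [partialDeriv]
  erw [h.fderiv]
  simp only [ContinuousLinearMap.comp_apply]
  convert (fderiv ℝ H (Fin.tail x)).map_zero
  ext j
  simp

theorem partialDeriv_integral_cons {H : (Fin (n + 1) → ℝ) → ℝ} (hH : ContDiff ℝ 1 H)
    (a b : ℝ) (i : Fin n) (y : Fin n → ℝ) :
    partialDeriv i (fun z => ∫ s in a..b, H (Fin.cons s z)) y =
      ∫ s in a..b, partialDeriv i.succ H (Fin.cons s y) := by
  have hF : ContDiff ℝ 1 (Function.uncurry fun (z : Fin n → ℝ) (s : ℝ) => H (Fin.cons s z)) :=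
    hH.comp contDiff_cons
  rw [partialDeriv, (hasFDerivAt_intervalIntegral_of_contDiff hF a b y).fderiv,
    ContinuousLinearMap.intervalIntegral_apply]
  · refine intervalIntegral.integral_congr fun s _ => ?_
    rw [← partialDeriv_cons (hH.differentiable one_ne_zero), partialDeriv]
    have := HasFDerivAt.comp (g := Function.uncurry fun (z : Fin n → ℝ) (s : ℝ) => H (Fin.cons s z))
      (f := fun e => (e, s)) y
      (hF.differentiable one_ne_zero (y, s)).hasFDerivAt (hasFDerivAt_prodMk_left y s)
    erw [this.fderiv]
  · refine Continuous.intervalIntegrable ?_ _ _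
    exact ((hF.continuous_fderiv one_ne_zero).comp
      (Continuous.prodMk continuous_const continuous_id)).clm_comp continuous_const

theorem partialDeriv_zero_primitive {K : (Fin (n + 1) → ℝ) → ℝ} (hK : ContDiff ℝ 1 K) (a : ℝ)
    (x : Fin (n + 1) → ℝ) :
    partialDeriv 0 (fun x => ∫ s in a..x 0, K (Fin.cons s (Fin.tail x))) x = K x := by
  have hP : ContDiff ℝ 1 (fun x : Fin (n + 1) → ℝ => ∫ s in a..x 0, K (Fin.cons s (Fin.tail x))) :=
    contDiff_primitive 1 (F := fun (x : Fin (n + 1) → ℝ) s => K (Fin.cons s (Fin.tail x)))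
      (hK.comp (contDiff_cons.comp ((contDiff_tail.comp contDiff_fst).prodMk contDiff_snd))) a
      (contDiff_apply ℝ ℝ 0)
  have h1 := (hP.differentiable one_ne_zero x).hasFDerivAt.hasLineDerivAt (Pi.single 0 1)
  rw [HasLineDerivAt] at h1
  have hcont : Continuous fun s : ℝ => K (Fin.cons s (Fin.tail x)) :=
    hK.continuous.comp ((contDiff_cons (k := 0)).continuous.comp
      (Continuous.prodMk continuous_const continuous_id))
  have h2 := (hcont.integral_hasStrictDerivAt a (x 0)).hasDerivAt
  have h3 : HasDerivAt (fun t : ℝ => ∫ s in a..(x 0 + t), K (Fin.cons s (Fin.tail x)))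
      (K x) 0 := by
    have := HasDerivAt.comp_const_add (x := (0 : ℝ)) (a := x 0) (by simpa using h2)
    simpa using this
  refine h1.unique (h3.congr_of_eventuallyEq (.of_forall fun t => ?_))
  have ht : Fin.tail (x + t • Pi.single (0 : Fin (n + 1)) (1 : ℝ)) = Fin.tail x := by
    ext j
    simp [Fin.tail]
  simp [ht]

end PartialDeriv

/-- The cube `[-R, R]ⁿ`. -/
def cube (n : ℕ) (R : ℝ) : Set (Fin n → ℝ) := Set.Icc (fun _ => -R) (fun _ => R)

theorem isCompact_cube (n : ℕ) (R : ℝ) : IsCompact (cube n R) := isCompact_Icc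

theorem integrableOn_cube {n : ℕ} {R : ℝ} {F : (Fin n → ℝ) → ℝ} (hF : Continuous F) :
    IntegrableOn F (cube n R) :=
  hF.continuousOn.integrableOn_compact (isCompact_cube n R)

theorem setIntegral_cube_succ {n : ℕ} {R : ℝ} (hR : 0 < R) {F : (Fin (n + 1) → ℝ) → ℝ}
    (hF : Continuous F) :
    ∫ x in cube (n + 1) R, F x = ∫ y in cube n R, ∫ s in -R..R, F (Fin.cons s y) := by
  let e := MeasurableEquiv.piFinSuccAbove (fun _ : Fin (n + 1) => ℝ) 0
  have he : MeasurePreserving e.symm :=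
    (volume_preserving_piFinSuccAbove (fun _ : Fin (n + 1) => ℝ) 0).symm
  have hes : ∀ p, e.symm p = (Fin.cons p.1 p.2 : Fin (n + 1) → ℝ) := fun p => by
    simp [e, MeasurableEquiv.piFinSuccAbove, Fin.insertNthEquiv]
  have hpre : e.symm ⁻¹' cube (n + 1) R = Set.Icc (-R) R ×ˢ cube n R := by
    ext p
    simp only [Set.mem_preimage, hes, cube, Set.mem_Icc, Pi.le_def, Set.mem_prod, Fin.forall_fin_succ,
      Fin.cons_zero, Fin.cons_succ]
    tauto
  rw [← he.setIntegral_preimage_emb e.symm.measurableEmbedding, hpre]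
  have hint : IntegrableOn (fun p => F (e.symm p)) (Set.Icc (-R) R ×ˢ cube n R)
      ((volume : Measure ℝ).prod volume) := by
    refine ContinuousOn.integrableOn_compact (isCompact_Icc.prod (isCompact_cube n R)) ?_
    simp only [hes]
    exact (hF.comp ((contDiff_cons (k := 0)).continuous.comp continuous_swap)).continuousOn
  rw [IntegrableOn, ← Measure.prod_restrict] at hint
  rw [Measure.volume_eq_prod, ← Measure.prod_restrict, integral_prod_symm _ hint]
  refine integral_congr_ae (.of_forall fun y => ?_)
  simp only [hes]
  rw [intervalIntegral.integral_of_le (by linarith), integral_Icc_eq_integral_Ioc]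

/-- A Knothe-type triangular solution of `div (ξ M) = -G` on a cube, tangential to its faces. -/
theorem exists_triangular_field {R : ℝ} (hR : 0 < R) : ∀ {n : ℕ} {M G : (Fin n → ℝ) → ℝ},
    ContDiff ℝ 2 M → (∀ x, 0 < M x) → ContDiff ℝ 1 G → ∫ x in cube n R, G x = 0 →
    ∃ ξ : Fin n → (Fin n → ℝ) → ℝ,
      (∀ i, ContDiff ℝ 1 (ξ i)) ∧
      (∀ i, ContDiff ℝ 1 (partialDeriv i (ξ i))) ∧
      (∀ i j, j < i → ∀ x, partialDeriv j (ξ i) x = 0) ∧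
      (∀ i j, j < i → ∀ x, partialDeriv j (partialDeriv i (ξ i)) x = 0) ∧
      (∀ i x, x i = -R ∨ x i = R → ξ i x = 0) ∧
      ∀ x, ∑ i, partialDeriv i (fun y => ξ i y * M y) x = -G x := by
  intro n
  induction n with
  | zero =>
    intro M G _ _ _ hG
    refine ⟨Fin.elim0, fun i => i.elim0, fun i => i.elim0, fun i => i.elim0, fun i => i.elim0,
      fun i => i.elim0, fun x => ?_⟩
    have hc : cube 0 R = Set.univ := Set.eq_univ_of_forall fun y => by simp [cube]
    rw [hc, Measure.restrict_univ, volume_pi, Measure.pi_of_empty _ x, integral_dirac] at hG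
    simp [hG]
  | succ n ih =>
    intro M G hM hM0 hG hG0
    have hM1 : ContDiff ℝ 1 M := hM.of_le one_le_two
    set M' : (Fin n → ℝ) → ℝ := fun y => ∫ s in -R..R, M (Fin.cons s y) with hM'
    set G' : (Fin n → ℝ) → ℝ := fun y => ∫ s in -R..R, G (Fin.cons s y) with hG'
    have hM'c : ContDiff ℝ 2 M' := contDiff_intervalIntegral 2
      (F := fun (y : Fin n → ℝ) s => M (Fin.cons s y)) (hM.comp contDiff_cons) _ _
    have hG'c : ContDiff ℝ 1 G' := contDiff_intervalIntegral 1
      (F := fun (y : Fin n → ℝ) s => G (Fin.cons s y)) (hG.comp contDiff_cons) _ _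
    have hcons : ∀ y : Fin n → ℝ, Continuous fun s : ℝ => (Fin.cons s y : Fin (n + 1) → ℝ) :=
      fun y => (contDiff_cons (k := 0)).continuous.comp
        (Continuous.prodMk continuous_const continuous_id)
    have hM'0 : ∀ y, 0 < M' y := fun y => intervalIntegral.intervalIntegral_pos_of_pos
      ((hM.continuous.comp (hcons y)).intervalIntegrable _ _) (fun s => hM0 _) (by linarith)
    obtain ⟨ξ, hξ, hd, htri, hdtri, hbd, heq⟩ := ih hM'c hM'0 hG'c
      (by rw [← setIntegral_cube_succ hR hG.continuous]; exact hG0)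
    have hξt : ∀ k, ContDiff ℝ 1 fun x : Fin (n + 1) → ℝ => ξ k (Fin.tail x) :=
      fun k => (hξ k).comp contDiff_tail
    have hpd : ∀ k, partialDeriv k.succ (fun x : Fin (n + 1) → ℝ => ξ k (Fin.tail x)) =
        fun x => partialDeriv k (ξ k) (Fin.tail x) := fun k => funext fun x =>
      partialDeriv_tail_succ ((hξ k).differentiable one_ne_zero) k x
    have hpdc : ∀ k, ContDiff ℝ 1
        (partialDeriv k.succ (fun x : Fin (n + 1) → ℝ => ξ k (Fin.tail x))) := fun k => by
      rw [hpd k]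
      exact (hd k).comp contDiff_tail
    set K : (Fin (n + 1) → ℝ) → ℝ := fun x => G x +
      ∑ k : Fin n, partialDeriv k.succ (fun x => ξ k (Fin.tail x) * M x) x with hK
    have hKc : ContDiff ℝ 1 K := by
      refine hG.add (ContDiff.sum fun k _ => ?_)
      have : partialDeriv k.succ (fun x => ξ k (Fin.tail x) * M x) = fun x =>
          ξ k (Fin.tail x) * partialDeriv k.succ M x +
            M x * partialDeriv k.succ (fun x : Fin (n + 1) → ℝ => ξ k (Fin.tail x)) x :=
        funext fun x => partialDeriv_mul (hξt k) hM1 k.succ x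
      rw [this]
      exact ((hξt k).mul (hM.partialDeriv (k := 2) (m := 1) le_rfl _)).add (hM1.mul (hpdc k))
    set P : (Fin (n + 1) → ℝ) → ℝ := fun x => ∫ s in -R..x 0, K (Fin.cons s (Fin.tail x)) with hP
    have hPc : ContDiff ℝ 1 P :=
      contDiff_primitive 1 (F := fun (x : Fin (n + 1) → ℝ) s => K (Fin.cons s (Fin.tail x)))
        (hKc.comp (contDiff_cons.comp ((contDiff_tail.comp contDiff_fst).prodMk contDiff_snd))) _
        (contDiff_apply ℝ ℝ 0)
    have hPd : ∀ x, partialDeriv 0 P x = K x := partialDeriv_zero_primitive hKc _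
    have hPR : ∀ y, ∫ s in -R..R, K (Fin.cons s y) = 0 := by
      intro y
      have hc : ∀ k : Fin n, ContDiff ℝ 1 fun x : Fin (n + 1) → ℝ => ξ k (Fin.tail x) * M x :=
        fun k => (hξt k).mul hM1
      have h1 : ∀ k : Fin n, ∫ s in -R..R,
          partialDeriv k.succ (fun x => ξ k (Fin.tail x) * M x) (Fin.cons s y) =
          partialDeriv k (fun y => ξ k y * M' y) y := fun k => by
        rw [← partialDeriv_integral_cons (hc k)]
        simp [hM']
      have hci : ∀ k : Fin n, IntervalIntegrable (fun s =>
          partialDeriv k.succ (fun x => ξ k (Fin.tail x) * M x) (Fin.cons s y)) volume (-R) R :=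
        fun k => (((hc k).continuous_partialDeriv _).comp (hcons y)).intervalIntegrable _ _
      simp only [hK]
      have hGi : IntervalIntegrable (fun s => G (Fin.cons s y)) volume (-R) R :=
        (hG.continuous.comp (hcons y)).intervalIntegrable _ _
      have hSi : IntervalIntegrable (fun s => ∑ k : Fin n,
          partialDeriv k.succ (fun x => ξ k (Fin.tail x) * M x) (Fin.cons s y)) volume (-R) R :=
        (continuous_finsetSum _ fun k _ =>
          ((hc k).continuous_partialDeriv _).comp (hcons y)).intervalIntegrable _ _
      rw [intervalIntegral.integral_add hGi hSi,
        intervalIntegral.integral_finsetSum fun k _ => hci k]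
      simp only [h1, heq]
      simp [hG']
    have hMi : ContDiff ℝ 2 fun x => -(M x)⁻¹ := (hM.inv fun x => (hM0 x).ne').neg
    have hMi1 := hMi.of_le one_le_two
    have hpd0 : partialDeriv 0 (fun x => P x * -(M x)⁻¹) = fun x =>
        P x * partialDeriv 0 (fun x => -(M x)⁻¹) x + -(M x)⁻¹ * K x := funext fun x => by
      rw [partialDeriv_mul hPc hMi1, hPd]
    refine ⟨Fin.cons (fun x => P x * -(M x)⁻¹) fun k x => ξ k (Fin.tail x), ?_, ?_, ?_, ?_, ?_, ?_⟩
    · intro i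
      refine Fin.cases ?_ (fun k => ?_) i
      · exact hPc.mul hMi1
      · exact hξt k
    · intro i
      refine Fin.cases ?_ (fun k => ?_) i
      · simp only [Fin.cons_zero]
        rw [hpd0]
        exact (hPc.mul (hMi.partialDeriv (k := 2) (m := 1) le_rfl _)).add (hMi1.mul hKc)
      · exact hpdc k
    · intro i
      refine Fin.cases ?_ (fun k => ?_) i
      · intro j hj
        exact absurd hj (Fin.not_lt_zero j)
      · intro j
        refine Fin.cases ?_ (fun l => ?_) j
        · intro _ x
          exact partialDeriv_tail_zero ((hξ k).differentiable one_ne_zero) x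
        · intro hl x
          simp only [Fin.cons_succ]
          rw [partialDeriv_tail_succ ((hξ k).differentiable one_ne_zero)]
          exact htri k l (Fin.succ_lt_succ_iff.1 hl) _
    · intro i
      refine Fin.cases ?_ (fun k => ?_) i
      · intro j hj
        exact absurd hj (Fin.not_lt_zero j)
      · intro j
        simp only [Fin.cons_succ, hpd]
        refine Fin.cases ?_ (fun l => ?_) j
        · intro _ x
          exact partialDeriv_tail_zero ((hd k).differentiable one_ne_zero) x
        · intro hl x
          rw [partialDeriv_tail_succ ((hd k).differentiable one_ne_zero)]
          exact hdtri k l (Fin.succ_lt_succ_iff.1 hl) _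
    · intro i
      refine Fin.cases ?_ (fun k => ?_) i
      · rintro x (hx | hx)
        · simp [hP, hx]
        · simp [hP, hx, hPR]
      · intro x hx
        exact hbd k _ hx
    · intro x
      rw [Fin.sum_univ_succ]
      have h0 : (fun y => P y * -(M y)⁻¹ * M y) = fun y => P y * (-1) := funext fun y => by
        have := (hM0 y).ne'
        field_simp
      simp only [Fin.cons_zero, Fin.cons_succ]
      rw [h0, partialDeriv_mul hPc contDiff_const, hPd]
      simp only [hK]
      simp [partialDeriv]

theorem setIntegral_partialDeriv_eq_zero {n : ℕ} {R : ℝ} (hR : 0 < R) {F : (Fin n → ℝ) → ℝ}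
    (hF : ContDiff ℝ 1 F) (j : Fin n) (h0 : ∀ x, x j = -R ∨ x j = R → F x = 0) :
    ∫ x in cube n R, partialDeriv j F x = 0 := by
  cases n with
  | zero => exact j.elim0
  | succ n =>
    have hsum : ∀ x, ∑ i, (if i = j then fderiv ℝ F x else 0) (Pi.single i 1) =
        partialDeriv j F x := fun x => by
      rw [Finset.sum_eq_single j]
      · simp [partialDeriv]
      · intro i _ hi
        simp [hi]
      · simp
    have h := integral_divergence_of_hasFDerivAt_off_countable' (fun _ => -R) (fun _ => R)
      (fun _ => by linarith) (fun i => if i = j then F else 0)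
      (fun i x => if i = j then fderiv ℝ F x else 0) ∅ Set.countable_empty
      (fun i => by
        split_ifs
        · exact hF.continuous.continuousOn
        · exact continuousOn_const)
      (fun x _ i => by
        split_ifs
        · exact (hF.differentiable one_ne_zero x).hasFDerivAt
        · exact hasFDerivAt_const 0 x)
      (by
        simp only [hsum]
        exact integrableOn_cube (hF.continuous_partialDeriv j))
    simp only [hsum] at h
    rw [cube, h]
    refine Finset.sum_eq_zero fun i _ => ?_
    by_cases hi : i = j
    · subst hi
      have h1 : ∀ x : Fin n → ℝ, F (i.insertNth R x) = 0 := fun x => h0 _ (by simp)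
      have h2 : ∀ x : Fin n → ℝ, F (i.insertNth (-R) x) = 0 := fun x => h0 _ (by simp)
      simp [h1, h2]
    · simp [hi]

theorem partialDeriv_comm {n : ℕ} {F : (Fin n → ℝ) → ℝ} (hF : ContDiff ℝ 2 F) (i j : Fin n)
    (x : Fin n → ℝ) :
    partialDeriv i (partialDeriv j F) x = partialDeriv j (partialDeriv i F) x := by
  have hd : DifferentiableAt ℝ (fderiv ℝ F) x :=
    (hF.fderiv_right (m := 1) le_rfl).differentiable one_ne_zero x
  have key : ∀ k l : Fin n, partialDeriv k (partialDeriv l F) x =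
      fderiv ℝ (fderiv ℝ F) x (Pi.single k 1) (Pi.single l 1) := fun k l => by
    change fderiv ℝ (fun y => fderiv ℝ F y (Pi.single l 1)) x _ = _
    rw [fderiv_clm_apply hd (differentiableAt_const _)]
    simp
  rw [key, key]
  exact (hF.contDiffAt.isSymmSndFDerivAt (by simp)).eq _ _

theorem mul_partialDeriv_rpow {n : ℕ} {w : (Fin n → ℝ) → ℝ} (hw : ContDiff ℝ 1 w)
    (hw0 : ∀ x, 0 < w x) (β : ℝ) (i : Fin n) (x : Fin n → ℝ) :
    w x * partialDeriv i (fun y => w y ^ (-β)) x = -β * w x ^ (-β) * partialDeriv i w x := by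
  have h := (hw.differentiable one_ne_zero x).hasFDerivAt.rpow_const (p := -β) (.inl (hw0 x).ne')
  rw [partialDeriv, h.fderiv, partialDeriv, Real.rpow_sub_one (hw0 x).ne']
  have := (hw0 x).ne'
  simp only [smul_apply, smul_eq_mul]
  field_simp

theorem setIntegral_cross_term {n : ℕ} {R β : ℝ} (hR : 0 < R) (hβ : (n : ℝ) ≤ β)
    {w : (Fin n → ℝ) → ℝ} (hw : ContDiff ℝ 2 w) (hw0 : ∀ x, 0 < w x)
    {ξ : Fin n → (Fin n → ℝ) → ℝ} (hξ : ∀ i, ContDiff ℝ 1 (ξ i))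
    (hd : ∀ i, ContDiff ℝ 1 (partialDeriv i (ξ i)))
    (htri : ∀ i j, j < i → ∀ x, partialDeriv j (ξ i) x = 0)
    (hdtri : ∀ i j, j < i → ∀ x, partialDeriv j (partialDeriv i (ξ i)) x = 0)
    (hbd : ∀ i x, x i = -R ∨ x i = R → ξ i x = 0) (i j : Fin n) :
    ∫ x in cube n R, (partialDeriv j (partialDeriv i w) x * ξ i x * ξ j x
        + partialDeriv i w x * ξ i x * partialDeriv j (ξ j) x
        + partialDeriv j w x * ξ j x * partialDeriv i (ξ i) x
        - β / w x * (partialDeriv i w x * ξ i x) * (partialDeriv j w x * ξ j x)) * w x ^ (-β) =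
      ∫ x in cube n R, if i = j then 0 else
        w x * w x ^ (-β) * (partialDeriv i (ξ i) x * partialDeriv j (ξ j) x) / (β - 1) := by
  have hμ : ContDiff ℝ 2 fun x => w x ^ (-β) := hw.rpow_const_of_ne fun x => (hw0 x).ne'
  have hw1 := hw.of_le one_le_two
  have hμ1 := hμ.of_le one_le_two
  have hD : ∀ i, ContDiff ℝ 1 (partialDeriv i w) := fun i =>
    hw.partialDeriv (k := 2) (m := 1) le_rfl i
  have hFc : ∀ i j, ContDiff ℝ 1
      fun x => (partialDeriv i w x * ξ i x) * (ξ j x * w x ^ (-β)) := fun i j =>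
    ((hD i).mul (hξ i)).mul ((hξ j).mul hμ1)
  have hF : ∀ i j x, partialDeriv j
      (fun x => (partialDeriv i w x * ξ i x) * (ξ j x * w x ^ (-β))) x =
      (partialDeriv j (partialDeriv i w) x * ξ i x * ξ j x
        + partialDeriv i w x * partialDeriv j (ξ i) x * ξ j x
        + partialDeriv i w x * ξ i x * partialDeriv j (ξ j) x
        - β / w x * (partialDeriv i w x * ξ i x) * (partialDeriv j w x * ξ j x))
          * w x ^ (-β) := by
    intro i j x
    rw [partialDeriv_mul ((hD i).mul (hξ i)) ((hξ j).mul hμ1), partialDeriv_mul (hD i) (hξ i),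
      partialDeriv_mul (hξ j) hμ1]
    have h1 : partialDeriv j (fun y => w y ^ (-β)) x =
        -β / w x * w x ^ (-β) * partialDeriv j w x := by
      have := mul_partialDeriv_rpow hw1 hw0 β j x
      have h2 := (hw0 x).ne'
      field_simp
      linarith
    rw [h1]
    ring
  have hF0 : ∀ i j, ∫ x in cube n R, partialDeriv j
      (fun x => (partialDeriv i w x * ξ i x) * (ξ j x * w x ^ (-β))) x = 0 := fun i j =>
    setIntegral_partialDeriv_eq_zero hR (hFc i j) j fun x hx => by simp [hbd j x hx]
  wlog hij : j ≤ i generalizing i j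
  · have := this j i (le_of_not_ge hij)
    simp only [partialDeriv_comm hw i j] at this
    convert this using 2
    · ext x
      ring
    · ext x
      simp only [eq_comm (a := i)]
      split_ifs
      · rfl
      · ring
  rcases hij.eq_or_lt with rfl | hlt
  · simp only [if_true]
    rw [integral_zero, ← hF0 j j]
    refine integral_congr_ae (.of_forall fun x => ?_)
    simp only [hF]
    ring
  · have hβ1 : β - 1 ≠ 0 := by
      have : (2 : ℝ) ≤ n := by
        exact_mod_cast (by have := i.2; have := Fin.lt_def.1 hlt; omega : 2 ≤ n)
      have : 2 ≤ β := this.trans hβ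
      intro h
      linarith
    have hBc : ContDiff ℝ 1
        fun x => (w x * w x ^ (-β)) * (ξ j x * partialDeriv i (ξ i) x) :=
      (hw1.mul hμ1).mul ((hξ j).mul (hd i))
    have hB : ∀ x, partialDeriv j
        (fun x => (w x * w x ^ (-β)) * (ξ j x * partialDeriv i (ξ i) x)) x =
        (1 - β) * w x ^ (-β) * partialDeriv j w x * ξ j x * partialDeriv i (ξ i) x +
          w x * w x ^ (-β) * (partialDeriv i (ξ i) x * partialDeriv j (ξ j) x) := by
      intro x
      rw [partialDeriv_mul (hw1.mul hμ1) ((hξ j).mul (hd i)), partialDeriv_mul hw1 hμ1,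
        partialDeriv_mul (hξ j) (hd i), hdtri i j hlt, mul_partialDeriv_rpow hw1 hw0]
      ring
    have hB0 : ∫ x in cube n R, partialDeriv j
        (fun x => (w x * w x ^ (-β)) * (ξ j x * partialDeriv i (ξ i) x)) x = 0 :=
      setIntegral_partialDeriv_eq_zero hR hBc j fun x hx => by simp [hbd j x hx]
    simp only [if_neg hlt.ne']
    have hFi := integrableOn_cube (R := R) ((hFc i j).continuous_partialDeriv j)
    have hBi := integrableOn_cube (R := R) (hBc.continuous_partialDeriv j)
    have hci : IntegrableOn (fun x => w x * w x ^ (-β) *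
        (partialDeriv i (ξ i) x * partialDeriv j (ξ j) x) / (β - 1)) (cube n R) :=
      integrableOn_cube ((((hw1.mul hμ1).mul ((hd i).mul (hd j))).div_const _).continuous)
    rw [← sub_eq_zero, ← integral_sub _ hci]
    · trans ∫ x in cube n R, (partialDeriv j
        (fun x => (partialDeriv i w x * ξ i x) * (ξ j x * w x ^ (-β))) x - partialDeriv j
        (fun x => (w x * w x ^ (-β)) * (ξ j x * partialDeriv i (ξ i) x)) x / (β - 1))
      · refine integral_congr_ae (.of_forall fun x => ?_)
        simp only [hF, hB, htri i j hlt]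
        field_simp
        ring
      · rw [integral_sub hFi (hBi.div_const _), integral_div, hF0, hB0]
        simp
    · have h := (hFi.add hci).sub (hBi.div_const (β - 1))
      refine h.congr (.of_forall fun x => ?_)
      simp only [Pi.add_apply, Pi.sub_apply, hF, hB, htri i j hlt]
      field_simp
      ring

theorem sq_sum_sub_sum_sq_div_le {n : ℕ} {β : ℝ} (hn : 1 ≤ n) (hβ : (n : ℝ) ≤ β)
    (d : Fin n → ℝ) :
    ((∑ i, d i) ^ 2 - ∑ i, d i ^ 2) / (β - 1) ≤ (∑ i, d i) ^ 2 / β := by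
  have hn1 : (1 : ℝ) ≤ n := by exact_mod_cast hn
  have hβ1 : 1 ≤ β := hn1.trans hβ
  rcases hβ1.eq_or_lt with rfl | h
  · simp only [sub_self, div_zero]
    positivity
  · have h1 : (∑ i, d i) ^ 2 ≤ n * ∑ i, d i ^ 2 := by
      simpa using sq_sum_le_card_mul_sum_sq (s := Finset.univ) (f := d)
    have h2 : 0 ≤ ∑ i, d i ^ 2 := Finset.sum_nonneg fun i _ => sq_nonneg _
    rw [div_le_div_iff₀ (by linarith) (by linarith)]
    nlinarith [mul_le_mul_of_nonneg_right hβ h2]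

/-- The weighted Hessian energy of a triangular field is controlled by its divergence. -/
theorem exists_field_hessian_energy_le {n : ℕ} {R β : ℝ} (hR : 0 < R) (hn : 1 ≤ n)
    (hβ : (n : ℝ) ≤ β) {w g : (Fin n → ℝ) → ℝ} (hw : ContDiff ℝ 2 w) (hw0 : ∀ x, 0 < w x)
    (hg : ContDiff ℝ 1 g) (hg0 : ∫ x in cube n R, g x * w x ^ (-β) = 0) :
    ∃ ξ : Fin n → (Fin n → ℝ) → ℝ, (∀ i, ContDiff ℝ 1 (ξ i)) ∧
      (∀ i x, x i = -R ∨ x i = R → ξ i x = 0) ∧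
      (∀ x, ∑ i, partialDeriv i (fun y => ξ i y * w y ^ (-β)) x = -(g x * w x ^ (-β))) ∧
      ∫ x in cube n R,
          (∑ i, ∑ j, partialDeriv j (partialDeriv i w) x * ξ i x * ξ j x) * w x ^ (-β) ≤
        β⁻¹ * ∫ x in cube n R, g x ^ 2 * w x * w x ^ (-β) := by
  have hn1 : (1 : ℝ) ≤ n := by exact_mod_cast hn
  have hβ1 : 1 ≤ β := hn1.trans hβ
  have hμ : ContDiff ℝ 2 fun x => w x ^ (-β) := hw.rpow_const_of_ne fun x => (hw0 x).ne'
  have hw1 := hw.of_le one_le_two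
  have hμ1 := hμ.of_le one_le_two
  have hD : ∀ i, ContDiff ℝ 1 (partialDeriv i w) := fun i =>
    hw.partialDeriv (k := 2) (m := 1) le_rfl i
  have hμ0 : ∀ x, 0 < w x ^ (-β) := fun x => Real.rpow_pos_of_pos (hw0 x) _
  obtain ⟨ξ, hξ, hd, htri, hdtri, hbd, heq⟩ :=
    exists_triangular_field hR hμ hμ0 (hg.mul hμ1) hg0
  refine ⟨ξ, hξ, hbd, heq, ?_⟩
  have hcross := fun i j => setIntegral_cross_term hR hβ hw hw0 hξ hd htri hdtri hbd i j
  set q : Fin n → Fin n → (Fin n → ℝ) → ℝ := fun i j x =>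
    (partialDeriv j (partialDeriv i w) x * ξ i x * ξ j x
        + partialDeriv i w x * ξ i x * partialDeriv j (ξ j) x
        + partialDeriv j w x * ξ j x * partialDeriv i (ξ i) x
        - β / w x * (partialDeriv i w x * ξ i x) * (partialDeriv j w x * ξ j x)) * w x ^ (-β)
    with hq
  set c : Fin n → Fin n → (Fin n → ℝ) → ℝ := fun i j x => if i = j then 0 else
    w x * w x ^ (-β) * (partialDeriv i (ξ i) x * partialDeriv j (ξ j) x) / (β - 1) with hc
  have hdw : ∀ k l, Continuous (partialDeriv k (partialDeriv l w)) := fun k l =>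
    (hD l).continuous_partialDeriv k
  have hdc := fun i => (hd i).continuous
  have hξc := fun i => (hξ i).continuous
  have hDc := fun i => (hD i).continuous
  have hwc := hw.continuous
  have hμc := hμ.continuous
  have hgc := hg.continuous
  have hwi : Continuous fun x => β / w x := continuous_const.div hwc fun x => (hw0 x).ne'
  have hqc : ∀ i j, Continuous (q i j) := fun i j => by
    have := hdw j i
    have := hdc i
    have := hdc j
    have := hξc i
    have := hξc j
    have := hDc i
    have := hDc j
    fun_prop
  have hcc : ∀ i j, Continuous (c i j) := fun i j => by
    have := hdc i
    have := hdc j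
    by_cases h : i = j
    · simp only [hc, h, if_true]
      fun_prop
    · simp only [hc, h, if_false]
      fun_prop
  have hsum : ∫ x in cube n R, ∑ i, ∑ j, q i j x = ∫ x in cube n R, ∑ i, ∑ j, c i j x := by
    rw [integral_finsetSum _ fun i _ => integrableOn_cube
        (continuous_finsetSum _ fun j _ => hqc i j),
      integral_finsetSum _ fun i _ => integrableOn_cube
        (continuous_finsetSum _ fun j _ => hcc i j)]
    refine Finset.sum_congr rfl fun i _ => ?_
    rw [integral_finsetSum _ fun j _ => integrableOn_cube (hqc i j),
      integral_finsetSum _ fun j _ => integrableOn_cube (hcc i j)]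
    exact Finset.sum_congr rfl fun j _ => hcross i j
  have hQ : Continuous fun x => ∑ i, ∑ j, q i j x :=
    continuous_finsetSum _ fun i _ => continuous_finsetSum _ fun j _ => hqc i j
  have hC : Continuous fun x => ∑ i, ∑ j, c i j x :=
    continuous_finsetSum _ fun i _ => continuous_finsetSum _ fun j _ => hcc i j
  have hH : Continuous fun x =>
      (∑ i, ∑ j, partialDeriv j (partialDeriv i w) x * ξ i x * ξ j x) * w x ^ (-β) :=
    (continuous_finsetSum _ fun i _ => continuous_finsetSum _ fun j _ =>
      ((hdw j i).mul (hξc i)).mul (hξc j)).mul hμc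
  have hG : Continuous fun x => g x ^ 2 * w x * w x ^ (-β) := by fun_prop
  have hpt : ∀ x,
      (∑ i, ∑ j, partialDeriv j (partialDeriv i w) x * ξ i x * ξ j x) * w x ^ (-β) ≤
        ∑ i, ∑ j, q i j x - ∑ i, ∑ j, c i j x + β⁻¹ * (g x ^ 2 * w x * w x ^ (-β)) := by
    intro x
    have hwx := hw0 x
    have hμx := hμ0 x
    set d : Fin n → ℝ := fun i => partialDeriv i (ξ i) x with hd'
    set D : ℝ := ∑ i, partialDeriv i w x * ξ i x with hDdef
    have hq' : ∑ i, ∑ j, q i j x =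
        ((∑ i, ∑ j, partialDeriv j (partialDeriv i w) x * ξ i x * ξ j x)
          + 2 * D * (∑ i, d i) - β / w x * D ^ 2) * w x ^ (-β) := by
      simp only [hq, ← Finset.sum_mul, Finset.sum_add_distrib, Finset.sum_sub_distrib,
        ← Finset.mul_sum, hDdef]
      ring
    have hc' : ∑ i, ∑ j, c i j x =
        w x * w x ^ (-β) * (((∑ i, d i) ^ 2 - ∑ i, d i ^ 2) / (β - 1)) := by
      have h1 : ∀ i j, c i j x = w x * w x ^ (-β) / (β - 1) *
          (d i * d j - if i = j then d i * d j else 0) := fun i j => by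
        simp only [hc, hd']
        split_ifs
        · ring
        · ring
      simp only [h1, ← Finset.mul_sum, Finset.sum_sub_distrib, Finset.sum_ite_eq,
        Finset.mem_univ, if_true, ← Finset.sum_mul]
      simp only [sq]
      ring
    have hDd : β * D = w x * (∑ i, d i + g x) := by
      have h1 : ∀ i, w x * partialDeriv i (fun y => ξ i y * w y ^ (-β)) x =
          (w x * d i - β * (partialDeriv i w x * ξ i x)) * w x ^ (-β) := fun i => by
        rw [partialDeriv_mul (hξ i) hμ1, mul_add]
        have := mul_partialDeriv_rpow hw1 hw0 β i x
        linear_combination ξ i x * this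
      have h2 := congrArg (w x * ·) (heq x)
      simp only [Finset.mul_sum, h1] at h2
      rw [← Finset.sum_mul, Finset.sum_sub_distrib, ← Finset.mul_sum, ← Finset.mul_sum] at h2
      have h3 : (w x * (∑ i, d i + g x) - β * D) * w x ^ (-β) = 0 := by
        linear_combination h2
      rcases mul_eq_zero.1 h3 with h | h
      · linarith
      · exact absurd h hμx.ne'
    have hβ0 : β ≠ 0 := by linarith
    have hD' : D = w x * (∑ i, d i + g x) / β := by
      field_simp
      linarith
    have hineq := mul_le_mul_of_nonneg_left (sq_sum_sub_sum_sq_div_le hn hβ d)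
      (mul_pos hwx hμx).le
    rw [hq', hc', hD']
    have e : (2 * (w x * (∑ i, d i + g x) / β) * ∑ i, d i
        - β / w x * (w x * (∑ i, d i + g x) / β) ^ 2) * w x ^ (-β)
        = w x * w x ^ (-β) * ((∑ i, d i) ^ 2 / β) - β⁻¹ * (g x ^ 2 * w x * w x ^ (-β)) := by
      field_simp
      ring
    linarith
  have hQi := integrableOn_cube (R := R) hQ
  have hCi := integrableOn_cube (R := R) hC
  have hGi := integrableOn_cube (R := R) hG
  have h := integral_mono (integrableOn_cube (R := R) hH)
    ((hQi.sub hCi).add (hGi.const_mul β⁻¹)) hpt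
  refine h.trans (le_of_eq ?_)
  rw [integral_add' (hQi.sub hCi) (hGi.const_mul β⁻¹), integral_sub' hQi hCi, hsum, sub_self,
    zero_add, integral_const_mul]

section EuclideanSpace

variable {n : ℕ}

theorem gradient_apply_eq_fderiv (F : EuclideanSpace ℝ (Fin n) → ℝ) (y : EuclideanSpace ℝ (Fin n))
    (i : Fin n) : gradient F y i = fderiv ℝ F y (EuclideanSpace.single i 1) := by
  have h := InnerProductSpace.toDual_symm_apply (𝕜 := ℝ) (x := EuclideanSpace.single i (1 : ℝ))
    (y := fderiv ℝ F y)
  rw [EuclideanSpace.inner_single_right, one_mul, conj_trivial] at h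
  exact h

theorem ContDiff.gradient_euclideanSpace {k m : ℕ} {F : EuclideanSpace ℝ (Fin n) → ℝ}
    (hF : ContDiff ℝ k F) (hm : m + 1 ≤ k) : ContDiff ℝ m (gradient F) := by
  refine contDiff_euclidean.2 fun i => ?_
  simp only [gradient_apply_eq_fderiv]
  exact (hF.fderiv_right (m := m) (by exact_mod_cast hm)).clm_apply contDiff_const

theorem contDiff_toLp_two {k : WithTop ℕ∞} :
    ContDiff ℝ k (WithLp.toLp 2 : (Fin n → ℝ) → EuclideanSpace ℝ (Fin n)) :=
  (EuclideanSpace.equiv (Fin n) ℝ).symm.contDiff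

theorem partialDeriv_comp_toLp {F : EuclideanSpace ℝ (Fin n) → ℝ} (hF : Differentiable ℝ F)
    (i : Fin n) (x : Fin n → ℝ) :
    partialDeriv i (fun x => F (WithLp.toLp 2 x)) x =
      fderiv ℝ F (WithLp.toLp 2 x) (EuclideanSpace.single i 1) := by
  have h := HasFDerivAt.comp (g := F) x (hF _).hasFDerivAt
    ((EuclideanSpace.equiv (Fin n) ℝ).symm.hasFDerivAt (x := x))
  rw [partialDeriv]
  erw [h.fderiv]
  rfl

theorem partialDeriv_partialDeriv_comp_toLp {F : EuclideanSpace ℝ (Fin n) → ℝ}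
    (hF : ContDiff ℝ 2 F) (i j : Fin n) (x : Fin n → ℝ) :
    partialDeriv j (partialDeriv i (fun x => F (WithLp.toLp 2 x))) x =
      fderiv ℝ (gradient F) (WithLp.toLp 2 x) (EuclideanSpace.single j 1) i := by
  have hG : Differentiable ℝ (gradient F) :=
    (hF.gradient_euclideanSpace (k := 2) (m := 1) le_rfl).differentiable one_ne_zero
  have h1 : partialDeriv i (fun x => F (WithLp.toLp 2 x)) =
      fun x => (fun y => gradient F y i) (WithLp.toLp 2 x) := funext fun x => by
    simp only [gradient_apply_eq_fderiv]
    exact partialDeriv_comp_toLp (hF.differentiable two_ne_zero) i x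
  have h2 : ∀ y, HasFDerivAt (fun y => gradient F y i)
      ((EuclideanSpace.proj i).comp (fderiv ℝ (gradient F) y)) y := fun y =>
    (EuclideanSpace.proj i : EuclideanSpace ℝ (Fin n) →L[ℝ] ℝ).hasFDerivAt.comp y
      (hG y).hasFDerivAt
  rw [h1, partialDeriv_comp_toLp (F := fun y => gradient F y i)
    (fun y => (h2 y).differentiableAt), (h2 _).fderiv]
  rfl

theorem inner_clm_apply_eq_sum (A : EuclideanSpace ℝ (Fin n) →L[ℝ] EuclideanSpace ℝ (Fin n))
    (u v : EuclideanSpace ℝ (Fin n)) :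
    ⟪A u, v⟫ = ∑ i, ∑ j, A (EuclideanSpace.single j 1) i * v i * u j := by
  have hu : u = ∑ j, u j • EuclideanSpace.single j (1 : ℝ) := by
    ext k
    simp [Pi.single_apply]
  have hA : ∀ i, A u i = ∑ j, u j * A (EuclideanSpace.single j 1) i := fun i => by
    conv_lhs => rw [hu]
    simp
  rw [PiLp.inner_apply]
  refine Finset.sum_congr rfl fun i _ => ?_
  simp only [hA, RCLike.inner_apply, conj_trivial, Finset.mul_sum]
  exact Finset.sum_congr rfl fun j _ => by ring

theorem inner_hessian_symm {F : EuclideanSpace ℝ (Fin n) → ℝ} (hF : ContDiff ℝ 2 F)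
    (y u v : EuclideanSpace ℝ (Fin n)) :
    ⟪fderiv ℝ (gradient F) y u, v⟫ = ⟪u, fderiv ℝ (gradient F) y v⟫ := by
  have h : ∀ i j, fderiv ℝ (gradient F) y (EuclideanSpace.single j 1) i =
      fderiv ℝ (gradient F) y (EuclideanSpace.single i 1) j := fun i j => by
    have := partialDeriv_comm (hF.comp contDiff_toLp_two) j i (WithLp.ofLp y)
    erw [partialDeriv_partialDeriv_comp_toLp hF, partialDeriv_partialDeriv_comp_toLp hF] at this
    simpa using this
  rw [real_inner_comm, real_inner_comm _ u, real_inner_comm, inner_clm_apply_eq_sum,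
    inner_clm_apply_eq_sum, Finset.sum_comm]
  refine Finset.sum_congr rfl fun i _ => Finset.sum_congr rfl fun j _ => ?_
  rw [h]
  ring

end EuclideanSpace

theorem isUnit_of_inner_pos {E : Type*} [NormedAddCommGroup E] [InnerProductSpace ℝ E]
    [FiniteDimensional ℝ E] {A : E →L[ℝ] E} (hA : ∀ v, v ≠ 0 → 0 < ⟪A v, v⟫) : IsUnit A := by
  have hinj : Function.Injective A := (injective_iff_map_eq_zero A).2 fun v hv => by
    by_contra h
    have := hA v h
    simp [hv] at this
  have : CompleteSpace E := FiniteDimensional.complete ℝ E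
  exact ContinuousLinearMap.isUnit_iff_bijective.2
    ⟨hinj, (LinearMap.injective_iff_surjective (f := A.toLinearMap)).1 hinj⟩

theorem two_mul_inner_sub_le_inner_inverse {E : Type*} [NormedAddCommGroup E]
    [InnerProductSpace ℝ E] [FiniteDimensional ℝ E] {A : E →L[ℝ] E}
    (hA : ∀ v, v ≠ 0 → 0 < ⟪A v, v⟫) (hsymm : ∀ u v, ⟪A u, v⟫ = ⟪u, A v⟫) (u v : E) :
    2 * ⟪v, u⟫ - ⟪A v, v⟫ ≤ ⟪Ring.inverse A u, u⟫ := by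
  have hz : A (Ring.inverse A u) = u := by
    have := congrArg (· u) (Ring.mul_inverse_cancel A (isUnit_of_inner_pos hA))
    simpa using this
  set z := Ring.inverse A u
  have h0 : 0 ≤ ⟪A (z - v), z - v⟫ := by
    by_cases h : z - v = 0
    · simp [h]
    · exact (hA _ h).le
  rw [map_sub, inner_sub_left, inner_sub_right, inner_sub_right, hsymm v z, hz] at h0
  rw [real_inner_comm u z]
  rw [real_inner_comm v u] at h0
  have := real_inner_comm v u
  linarith

theorem integral_eq_setIntegral_cube {n : ℕ} {R : ℝ} {F : EuclideanSpace ℝ (Fin n) → ℝ}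
    (hF : ∀ y, WithLp.ofLp y ∉ cube n R → F y = 0) :
    ∫ y, F y = ∫ x in cube n R, F (WithLp.toLp 2 x) := by
  rw [setIntegral_eq_integral_of_forall_compl_eq_zero fun x hx => hF _ hx]
  exact ((EuclideanSpace.volume_preserving_symm_measurableEquiv_toLp (Fin n)).symm.integral_comp'
    (g := F)).symm

theorem HasCompactSupport.exists_cube {n : ℕ} {g : EuclideanSpace ℝ (Fin n) → ℝ}
    (hg : HasCompactSupport g) :
    ∃ R, 0 < R ∧ ∀ y, WithLp.ofLp y ∉ cube n R → y ∉ tsupport g := by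
  obtain ⟨R, hR0, hR⟩ := hg.isCompact.isBounded.subset_closedBall_lt 0 0
  refine ⟨R, hR0, fun y hy h => hy ?_⟩
  have hn : ‖y‖ ≤ R := by simpa using hR h
  have hi : ∀ i, |y i| ≤ R := fun i => (PiLp.norm_apply_le y i).trans hn
  exact ⟨fun i => (abs_le.1 (hi i)).1, fun i => (abs_le.1 (hi i)).2⟩

/-- dimensional Brascamp–Lieb, Case 2: for `β ≥ n`, `W > 0` convex and
`C²` on `ℝⁿ` with `∫ W^{-β} = 1` and `D²W > 0` everywhere, every `C¹` compactly
supported function `g` with `∫ g W^{-β} = 0` satisfies, for `f = g W`,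
`∫ ⟨(D²W)⁻¹ ∇f, ∇f⟩ W^{-β} ≥ β ∫ g² W W^{-β}`.
The Hessian is `D²W x = fderiv ℝ (gradient W) x`, and the inverse of the corresponding
continuous linear map is taken in the ring of endomorphisms. -/
theorem dimensional_brascamp_lieb_case2
    (n : ℕ) (hn : 1 ≤ n) (β : ℝ) (hβ : (n : ℝ) ≤ β)
    (W : EuclideanSpace ℝ (Fin n) → ℝ) (hW0 : ∀ x, 0 < W x)
    (hconv : ConvexOn ℝ Set.univ W) (hC2 : ContDiff ℝ 2 W)
    (hnorm : (∫ x, W x ^ (-β)) = 1)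
    (hhess : ∀ x : EuclideanSpace ℝ (Fin n), ∀ v : EuclideanSpace ℝ (Fin n), v ≠ 0 →
      0 < ⟪fderiv ℝ (gradient W) x v, v⟫)
    (g : EuclideanSpace ℝ (Fin n) → ℝ) (hg : ContDiff ℝ 1 g)
    (hgsupp : HasCompactSupport g)
    (hgmean : (∫ x, g x * W x ^ (-β)) = 0) :
    (∫ x, ⟪Ring.inverse (fderiv ℝ (gradient W) x)
        (gradient (fun y => g y * W y) x), gradient (fun y => g y * W y) x⟫ *
        W x ^ (-β)) ≥
      β * ∫ x, g x ^ 2 * W x * W x ^ (-β) := by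
  obtain ⟨R, hR, hsupp⟩ := hgsupp.exists_cube
  have hn1 : (1 : ℝ) ≤ n := by exact_mod_cast hn
  have hβ0 : 0 < β := by linarith
  set w : (Fin n → ℝ) → ℝ := fun x => W (WithLp.toLp 2 x) with hw_def
  set h : (Fin n → ℝ) → ℝ := fun x => g (WithLp.toLp 2 x) with hh_def
  set f : EuclideanSpace ℝ (Fin n) → ℝ := fun y => g y * W y with hf_def
  have hw : ContDiff ℝ 2 w := hC2.comp contDiff_toLp_two
  have hh : ContDiff ℝ 1 h := hg.comp contDiff_toLp_two
  have hf : ContDiff ℝ 1 f := hg.mul (hC2.of_le one_le_two)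
  have hw0 : ∀ x, 0 < w x := fun x => hW0 _
  have hμ : ContDiff ℝ 1 fun x => w x ^ (-β) :=
    (hw.of_le one_le_two).rpow_const_of_ne fun x => (hw0 x).ne'
  have hg0 : ∀ y, WithLp.ofLp y ∉ cube n R → g y = 0 := fun y hy =>
    image_eq_zero_of_notMem_tsupport (hsupp y hy)
  have hf0 : ∀ y, WithLp.ofLp y ∉ cube n R → gradient f y = 0 := fun y hy => by
    have h1 : f =ᶠ[nhds y] fun _ => 0 := by
      filter_upwards [notMem_tsupport_iff_eventuallyEq.1 (hsupp y hy)] with z hz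
      simp [hf_def, hz]
    rw [gradient, h1.fderiv_eq]
    simp
  rw [integral_eq_setIntegral_cube (R := R) fun y hy => by simp [hg0 y hy]] at hgmean
  rw [integral_eq_setIntegral_cube (R := R) fun y hy => by simp [hf0 y hy],
    integral_eq_setIntegral_cube (R := R) fun y hy => by simp [hg0 y hy]]
  obtain ⟨ξ, hξ, hbd, heq, hen⟩ := exists_field_hessian_energy_le hR hn hβ hw hw0 hh hgmean
  have hfx : ContDiff ℝ 1 fun x : Fin n → ℝ => f (WithLp.toLp 2 x) := hf.comp contDiff_toLp_two
  have hξμ : ∀ i, ContDiff ℝ 1 fun x => ξ i x * w x ^ (-β) := fun i => (hξ i).mul hμ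
  have hgf : ∀ i x, partialDeriv i (fun x => f (WithLp.toLp 2 x)) x =
      gradient f (WithLp.toLp 2 x) i := fun i x => by
    rw [gradient_apply_eq_fderiv, partialDeriv_comp_toLp (hf.differentiable one_ne_zero)]
  have hgc : Continuous fun x : Fin n → ℝ => gradient f (WithLp.toLp 2 x) :=
    (hf.gradient_euclideanSpace (k := 1) (m := 0) le_rfl).continuous.comp
      (contDiff_toLp_two (k := 0)).continuous
  have hHc : Continuous fun x : Fin n → ℝ => fderiv ℝ (gradient W) (WithLp.toLp 2 x) :=
    ((hC2.gradient_euclideanSpace (k := 2) (m := 1) le_rfl).continuous_fderiv one_ne_zero).comp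
      (contDiff_toLp_two (k := 0)).continuous
  have hinv : Continuous fun x : Fin n → ℝ =>
      Ring.inverse (fderiv ℝ (gradient W) (WithLp.toLp 2 x)) :=
    continuous_iff_continuousAt.2 fun x => by
      obtain ⟨u, hu⟩ := isUnit_of_inner_pos (hhess (WithLp.toLp 2 x))
      have := NormedRing.inverse_continuousAt u
      rw [hu] at this
      exact ContinuousAt.comp (g := Ring.inverse)
        (f := fun x : Fin n → ℝ => fderiv ℝ (gradient W) (WithLp.toLp 2 x)) this hHc.continuousAt
  have hlhs : IntegrableOn (fun x => ⟪Ring.inverse (fderiv ℝ (gradient W) (WithLp.toLp 2 x))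
      (gradient f (WithLp.toLp 2 x)), gradient f (WithLp.toLp 2 x)⟫ * w x ^ (-β)) (cube n R) :=
    integrableOn_cube (((hinv.clm_apply hgc).inner hgc).mul hμ.continuous)
  have hV : Continuous fun x => (WithLp.toLp 2 fun i => ξ i x : EuclideanSpace ℝ (Fin n)) :=
    (contDiff_toLp_two (k := 0)).continuous.comp (continuous_pi fun i => (hξ i).continuous)
  have hpair : IntegrableOn (fun x => ⟪(WithLp.toLp 2 fun i => ξ i x : EuclideanSpace ℝ (Fin n)),
      gradient f (WithLp.toLp 2 x)⟫ * w x ^ (-β)) (cube n R) :=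
    integrableOn_cube ((hV.inner hgc).mul hμ.continuous)
  have hquad : IntegrableOn (fun x => ⟪fderiv ℝ (gradient W) (WithLp.toLp 2 x)
      (WithLp.toLp 2 fun i => ξ i x), (WithLp.toLp 2 fun i => ξ i x)⟫ * w x ^ (-β)) (cube n R) :=
    integrableOn_cube (((hHc.clm_apply hV).inner hV).mul hμ.continuous)
  have hibp : ∫ x in cube n R, ⟪(WithLp.toLp 2 fun i => ξ i x : EuclideanSpace ℝ (Fin n)),
      gradient f (WithLp.toLp 2 x)⟫ * w x ^ (-β) =
      ∫ x in cube n R, h x ^ 2 * w x * w x ^ (-β) := by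
    have hi : ∀ i, IntegrableOn (partialDeriv i
        fun x => f (WithLp.toLp 2 x) * (ξ i x * w x ^ (-β))) (cube n R) := fun i =>
      integrableOn_cube ((hfx.mul (hξμ i)).continuous_partialDeriv i)
    have hz : ∫ x in cube n R, ∑ i, partialDeriv i
        (fun x => f (WithLp.toLp 2 x) * (ξ i x * w x ^ (-β))) x = 0 := by
      rw [integral_finsetSum _ fun i _ => hi i]
      exact Finset.sum_eq_zero fun i _ => setIntegral_partialDeriv_eq_zero hR (hfx.mul (hξμ i)) i
        fun x hx => by simp [hbd i x hx]
    have hrhs : IntegrableOn (fun x => h x ^ 2 * w x * w x ^ (-β)) (cube n R) :=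
      integrableOn_cube (((hh.continuous.pow 2).mul hw.continuous).mul hμ.continuous)
    rw [← sub_eq_zero, ← integral_sub hpair hrhs, ← hz]
    refine integral_congr_ae (.of_forall fun x => ?_)
    simp only [partialDeriv_mul hfx (hξμ _), Finset.sum_add_distrib, ← Finset.mul_sum, heq, hgf,
      PiLp.inner_apply, RCLike.inner_apply, conj_trivial, Finset.sum_mul]
    rw [sub_eq_neg_add]
    congr 1
    · simp only [hf_def, hh_def, hw_def]
      ring
    · exact Finset.sum_congr rfl fun i _ => by ring
  have hen' : ∫ x in cube n R, ⟪fderiv ℝ (gradient W) (WithLp.toLp 2 x)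
        (WithLp.toLp 2 fun i => ξ i x), (WithLp.toLp 2 fun i => ξ i x)⟫ * w x ^ (-β) ≤
      β⁻¹ * ∫ x in cube n R, h x ^ 2 * w x * w x ^ (-β) := by
    refine le_of_eq_of_le (integral_congr_ae (.of_forall fun x => ?_)) hen
    simp only [inner_clm_apply_eq_sum]
    simp only [hw_def, partialDeriv_partialDeriv_comp_toLp hC2]
  have hmono := integral_mono ((hpair.const_mul (2 * β)).sub (hquad.const_mul (β ^ 2))) hlhs
    fun x => by
      have h1 := two_mul_inner_sub_le_inner_inverse (hhess (WithLp.toLp 2 x))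
        (inner_hessian_symm hC2 (WithLp.toLp 2 x)) (gradient f (WithLp.toLp 2 x))
        (β • (WithLp.toLp 2 fun i => ξ i x : EuclideanSpace ℝ (Fin n)))
      rw [map_smul, inner_smul_left, inner_smul_left, inner_smul_right, conj_trivial] at h1
      have h2 := mul_le_mul_of_nonneg_right h1 (Real.rpow_pos_of_pos (hw0 x) (-β)).le
      simp only [Pi.sub_apply]
      linarith
  rw [integral_sub' (hpair.const_mul (2 * β)) (hquad.const_mul (β ^ 2)), integral_const_mul,
    integral_const_mul, hibp] at hmono
  refine le_trans ?_ hmono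
  have h3 := mul_le_mul_of_nonneg_left hen' (sq_nonneg β)
  have h4 : β ^ 2 * (β⁻¹ * ∫ x in cube n R, h x ^ 2 * w x * w x ^ (-β)) =
      β * ∫ x in cube n R, h x ^ 2 * w x * w x ^ (-β) := by
    field_simp
  linarith
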